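/- ∫₀¹ log(x⁵ + 1)/(x² + 1) dx = −(3π/8)·log 2 − 2G + Ti₂(1 + √5 − √(5 + 2√5)) + Ti₂(1 − √5 + √(5 − 2√5)) + (π/2)·log(1 + √5 + √(10 + 2√5)). -/

import Mathlib

open Real MeasureTheory intervalIntegral Finset

/-- Inverse tangent integral Ti₂(x) = ∫₀ˣ arctan u / u du. -/
noncomputable def Ti2 (x : ℝ) : ℝ := ∫ u in (0:ℝ)..x, Real.arctan u / u

/-- Catalan's constant G = Σ_{k≥0} (-1)^k/(2k+1)². -/
noncomputable def catalanG : ℝ := ∑' k : ℕ, (-1 : ℝ) ^ k / (2 * (k : ℝ) + 1) ^ 2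

/-- The basic quadratic. -/
noncomputable def qD (t x : ℝ) : ℝ := (1 + t ^ 2) * (1 + x ^ 2) + 4 * t * x

noncomputable def qL (t : ℝ) : ℝ := ∫ x in (0:ℝ)..1, Real.log (qD t x) / (1 + x ^ 2)

lemma qD_lower {r t x : ℝ} (hr : 0 < r) (hr1 : r ≤ 1) (ht : r - 1 ≤ t) (hx : x ∈ Set.Icc (0:ℝ) 1) :
    r ^ 2 ≤ qD t x := by
  obtain ⟨h0, h1⟩ := hx
  have h : r ≤ 1 + t * x := by
    nlinarith [mul_nonneg (sub_nonneg.2 ht) h0, mul_nonneg (sub_nonneg.2 hr1) (sub_nonneg.2 h1)]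
  have : r ^ 2 ≤ (1 + t * x) ^ 2 := by gcongr
  unfold qD
  nlinarith [sq_nonneg (t + x)]

lemma qD_pos {t x : ℝ} (ht : -1 < t) (hx : x ∈ Set.Icc (0:ℝ) 1) : 0 < qD t x := by
  have h := qD_lower (r := min 1 (1 + t)) (t := t) (x := x) (lt_min one_pos (by linarith)) (min_le_left _ _)
    (by linarith [min_le_right 1 (1 + t)]) hx
  have : 0 < min 1 (1 + t) := lt_min one_pos (by linarith)
  exact lt_of_lt_of_le (by positivity) h

lemma qlog_cont {t : ℝ} (ht : -1 < t) :
    ContinuousOn (fun x => Real.log (qD t x) / (1 + x ^ 2)) (Set.Icc 0 1) := by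
  apply ContinuousOn.div
  · apply ContinuousOn.log
    · unfold qD; fun_prop
    · intro x hx; exact (qD_pos ht hx).ne'
  · fun_prop
  · intro x _; positivity

lemma qlog_int {t : ℝ} (ht : -1 < t) :
    IntervalIntegrable (fun x => Real.log (qD t x) / (1 + x ^ 2)) volume 0 1 :=
  (by rw [Set.uIcc_of_le zero_le_one]; exact qlog_cont ht : ContinuousOn _ (Set.uIcc (0:ℝ) 1)).intervalIntegrable

lemma uIoc_sub {x : ℝ} (hx : x ∈ Set.uIoc (0:ℝ) 1) : x ∈ Set.Icc (0:ℝ) 1 := by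
  rw [Set.uIoc_of_le zero_le_one] at hx
  exact ⟨hx.1.le, hx.2⟩

lemma qL_hasDeriv {t : ℝ} (ht : -1 < t) :
    HasDerivAt qL (∫ x in (0:ℝ)..1, (2 * t * (1 + x ^ 2) + 4 * x) / qD t x / (1 + x ^ 2)) t := by
  set r : ℝ := min 1 ((1 + t) / 2) with hr
  have hr0 : 0 < r := lt_min one_pos (by linarith)
  have hr1 : r ≤ 1 := min_le_left _ _
  have hr2 : r ≤ (1 + t) / 2 := min_le_right _ _
  have hs : Set.Ioo (r - 1) (t + 1) ∈ nhds t := Ioo_mem_nhds (by linarith) (by linarith)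
  refine (intervalIntegral.hasDerivAt_integral_of_dominated_loc_of_deriv_le (μ := volume)
    (F := fun t x => Real.log (qD t x) / (1 + x ^ 2))
    (F' := fun t x => (2 * t * (1 + x ^ 2) + 4 * x) / qD t x / (1 + x ^ 2))
    (bound := fun _ => (2 * (|t| + 1) * 2 + 4) / r ^ 2) hs ?_ (qlog_int ht) ?_ ?_ ?_ ?_).2
  · filter_upwards [hs] with s hs
    have := (qlog_int (t := s) (by linarith [hs.1]))
    rw [intervalIntegrable_iff] at this
    exact this.aestronglyMeasurable
  · apply Measurable.aestronglyMeasurable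
    unfold qD; fun_prop
  · refine Filter.Eventually.of_forall fun x hx s hs => ?_
    have hx := uIoc_sub hx
    have h1 := qD_lower hr0 hr1 hs.1.le hx
    have h2 : |s| ≤ |t| + 1 := by
      have := hs.2
      have := hs.1
      rw [abs_le]
      constructor
      · rcases abs_cases t with h | h <;> linarith
      · linarith [le_abs_self t]
    have hx2 : x ^ 2 ≤ 1 := by nlinarith [hx.1, hx.2]
    rw [Real.norm_eq_abs, abs_div, abs_div, abs_of_pos (qD_pos (by linarith [hs.1]) hx),
      abs_of_pos (by positivity : 0 < 1 + x ^ 2)]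
    refine (div_le_self (by have := qD_pos (t := s) (by linarith [hs.1]) hx; positivity) (by nlinarith [sq_nonneg x])).trans ?_
    gcongr
    refine (abs_add_le _ _).trans ?_
    rw [abs_mul, abs_mul, abs_mul, abs_of_nonneg hx.1, abs_of_pos (by positivity : 0 < 1 + x ^ 2)]
    norm_num
    have : 2 * |s| * (1 + x ^ 2) ≤ 2 * (|t| + 1) * 2 := by
      gcongr; linarith
    linarith [hx.2]
  · exact intervalIntegrable_const
  · refine Filter.Eventually.of_forall fun x hx s hs => ?_
    have hx := uIoc_sub hx
    have hp := qD_pos (t := s) (by linarith [hs.1]) hx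
    have hd : HasDerivAt (fun s => qD s x) (2 * s * (1 + x ^ 2) + 4 * x) s := by
      unfold qD
      have h := (((hasDerivAt_id s).pow 2).const_add 1).mul_const (1 + x ^ 2)
      have h' := ((hasDerivAt_id s).const_mul 4).mul_const x
      refine HasDerivAt.congr_deriv (h.add h') ?_
      simp
    exact (hd.log hp.ne').div_const _

lemma int_one_div : ∫ x in (0:ℝ)..1, 1 / (1 + x ^ 2) = π / 4 := by
  rw [integral_one_div_one_add_sq]; simp

lemma qL_deriv_val {t : ℝ} (ht : -1 < t) (ht1 : t < 1) (h0 : t ≠ 0) :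
    ∫ x in (0:ℝ)..1, (2 * t * (1 + x ^ 2) + 4 * x) / qD t x / (1 + x ^ 2) = arctan t / t := by
  have h1t : 0 < 1 - t ^ 2 := by nlinarith
  have key : ∀ x ∈ Set.uIcc (0:ℝ) 1, HasDerivAt
      (fun x => (arctan x - arctan (((1 + t ^ 2) * x + 2 * t) / (1 - t ^ 2))) / t)
      ((2 * t * (1 + x ^ 2) + 4 * x) / qD t x / (1 + x ^ 2)) x := by
    intro x hx
    rw [Set.uIcc_of_le zero_le_one] at hx
    have hp := qD_pos ht hx
    have hl : HasDerivAt (fun x : ℝ => ((1 + t ^ 2) * x + 2 * t) / (1 - t ^ 2)) ((1 + t ^ 2) / (1 - t ^ 2)) x := by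
      have := (((hasDerivAt_id x).const_mul (1 + t ^ 2)).add_const (2 * t)).div_const (1 - t ^ 2)
      simpa using this
    have h := ((hasDerivAt_arctan x).sub hl.arctan).div_const t
    refine HasDerivAt.congr_deriv h ?_
    have e : 1 + (((1 + t ^ 2) * x + 2 * t) / (1 - t ^ 2)) ^ 2 = (1 + t ^ 2) * qD t x / (1 - t ^ 2) ^ 2 := by
      unfold qD; field_simp; ring
    rw [e]
    have hx1 : 1 + x ^ 2 ≠ 0 := by positivity
    have ht1 : 1 + t ^ 2 ≠ 0 := by positivity
    have hp' := hp.ne'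
    have h1t' := h1t.ne'
    field_simp
    unfold qD; ring
  rw [integral_eq_sub_of_hasDerivAt key]
  · have e1 : ((1 + t ^ 2) * 1 + 2 * t) / (1 - t ^ 2) = (1 + t) / (1 - 1 * t) := by
      have : 1 - t ≠ 0 := by linarith
      have := h1t.ne'
      field_simp; ring
    have e2 : ((1 + t ^ 2) * 0 + 2 * t) / (1 - t ^ 2) = 2 * t / (1 - t ^ 2) := by simp
    rw [e1, e2, ← two_mul_arctan ht ht1, ← arctan_add (by linarith)]
    simp; ring
  · apply ContinuousOn.intervalIntegrable
    rw [Set.uIcc_of_le zero_le_one]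
    apply ContinuousOn.div
    · apply ContinuousOn.div
      · fun_prop
      · unfold qD; fun_prop
      · intro x hx; exact (qD_pos ht hx).ne'
    · fun_prop
    · intro x _; positivity

lemma arctan_div_bound (u : ℝ) : |arctan u / u| ≤ 1 := by
  rcases eq_or_ne u 0 with rfl | h
  · simp
  have aux : ∀ v : ℝ, 0 < v → arctan v ≤ v := fun v hv => by
    have := le_tan (arctan_nonneg.2 hv.le) (arctan_lt_pi_div_two v)
    rwa [tan_arctan] at this
  rw [abs_div, div_le_one (abs_pos.2 h)]
  rcases lt_or_gt_of_ne h with h | h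
  · rw [abs_of_neg h, abs_of_neg (arctan_lt_zero.2 h), ← arctan_neg]
    exact aux _ (by linarith)
  · rw [abs_of_pos h, abs_of_pos (arctan_pos.2 h)]
    exact aux _ h

lemma arctan_div_int (a b : ℝ) : IntervalIntegrable (fun u => arctan u / u) volume a b := by
  apply (intervalIntegrable_const (c := (1:ℝ))).mono_fun
  · apply Measurable.aestronglyMeasurable
    exact measurable_arctan.div measurable_id
  · refine Filter.Eventually.of_forall fun u => ?_
    simpa [abs_div] using arctan_div_bound u

lemma qL_eq {t : ℝ} (ht : -1 < t) (ht1 : t ≤ 1) : qL t = qL 0 + Ti2 t := by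
  have hc : ∀ s, -1 < s → ContinuousAt qL s := fun s hs => (qL_hasDeriv hs).continuousAt
  have hd : ∀ s, -1 < s → s < 1 → s ≠ 0 → HasDerivAt qL (arctan s / s) s := fun s h1 h2 h3 => by
    rw [← qL_deriv_val h1 h2 h3]; exact qL_hasDeriv h1
  unfold Ti2
  rcases le_total 0 t with h | h
  · rw [integral_eq_sub_of_hasDerivAt_of_le h (f := qL) _ _ (arctan_div_int _ _)]
    · ring
    · intro s hs; exact (hc s (by linarith [hs.1])).continuousWithinAt
    · intro s hs; exact hd s (by linarith [hs.1]) (by linarith [hs.2]) hs.1.ne'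
  · rw [integral_symm, integral_eq_sub_of_hasDerivAt_of_le h (f := qL) _ _ (arctan_div_int _ _)]
    · ring
    · intro s hs; exact (hc s (by linarith [hs.1])).continuousWithinAt
    · intro s hs; exact hd s (by linarith [hs.1]) (by linarith [hs.2]) hs.2.ne

lemma log1_cont : ContinuousOn (fun x : ℝ => Real.log (1 + x) / (1 + x ^ 2)) (Set.Icc 0 1) := by
  apply ContinuousOn.div
  · apply ContinuousOn.log
    · fun_prop
    · intro x hx; have := hx.1; positivity
  · fun_prop
  · intro x _; positivity

lemma log1_int : IntervalIntegrable (fun x : ℝ => Real.log (1 + x) / (1 + x ^ 2)) volume 0 1 :=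
  (by rw [Set.uIcc_of_le zero_le_one]; exact log1_cont : ContinuousOn _ (Set.uIcc (0:ℝ) 1)).intervalIntegrable

lemma c_int (c : ℝ) : IntervalIntegrable (fun x : ℝ => c * (1 / (1 + x ^ 2))) volume 0 1 := by
  apply Continuous.intervalIntegrable
  apply Continuous.mul continuous_const
  exact continuous_const.div (by fun_prop) (fun x => by positivity)

lemma log1_val : ∫ x in (0:ℝ)..1, Real.log (1 + x) / (1 + x ^ 2) = π / 8 * Real.log 2 := by
  have hs := integral_comp_mul_deriv' (a := 0) (b := 1) (f := fun x : ℝ => (1 - x) / (1 + x))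
    (f' := fun x => -2 / (1 + x) ^ 2) (g := fun x : ℝ => Real.log (1 + x) / (1 + x ^ 2)) ?_ ?_ ?_
  · have e : ∫ x in (0:ℝ)..1, ((fun x : ℝ => Real.log (1 + x) / (1 + x ^ 2)) ∘ (fun x : ℝ => (1 - x) / (1 + x))) x
        * (-2 / (1 + x) ^ 2) = ∫ x in (0:ℝ)..1, (Real.log (1 + x) / (1 + x ^ 2) - Real.log 2 * (1 / (1 + x ^ 2))) := by
      apply integral_congr
      intro x hx
      rw [Set.uIcc_of_le zero_le_one] at hx
      have h1 : 0 < 1 + x := by linarith [hx.1]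
      have e1 : 1 + (1 - x) / (1 + x) = 2 / (1 + x) := by field_simp; ring
      have e2 : 1 + ((1 - x) / (1 + x)) ^ 2 = 2 * (1 + x ^ 2) / (1 + x) ^ 2 := by field_simp; ring
      simp only [Function.comp]
      rw [e1, e2, Real.log_div (by norm_num) h1.ne']
      have : 1 + x ^ 2 ≠ 0 := by positivity
      field_simp; ring
    rw [e, integral_sub log1_int (c_int _), intervalIntegral.integral_const_mul, int_one_div] at hs
    norm_num at hs
    rw [integral_symm 0 1] at hs
    linarith
  · intro x hx
    rw [Set.uIcc_of_le zero_le_one] at hx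
    have h1 : 1 + x ≠ 0 := by linarith [hx.1]
    have := ((hasDerivAt_id x).const_sub 1).div ((hasDerivAt_id x).const_add 1) h1
    refine HasDerivAt.congr_deriv this ?_
    simp; ring
  · rw [Set.uIcc_of_le zero_le_one]
    apply ContinuousOn.div
    · fun_prop
    · fun_prop
    · intro x hx; have := hx.1; positivity
  · apply log1_cont.mono
    rintro _ ⟨x, hx, rfl⟩
    rw [Set.uIcc_of_le zero_le_one] at hx
    have h1 : 0 < 1 + x := by linarith [hx.1]
    exact ⟨div_nonneg (by linarith [hx.2]) h1.le, by rw [div_le_one h1]; linarith [hx.1]⟩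

lemma qL_one : qL 1 = π / 2 * Real.log 2 := by
  have : qL 1 = ∫ x in (0:ℝ)..1, (Real.log 2 * (1 / (1 + x ^ 2)) + 2 * (Real.log (1 + x) / (1 + x ^ 2))) := by
    unfold qL
    apply integral_congr
    intro x hx
    rw [Set.uIcc_of_le zero_le_one] at hx
    have h1 : 0 < 1 + x := by linarith [hx.1]
    have e : qD 1 x = 2 * (1 + x) ^ 2 := by unfold qD; ring
    simp only
    rw [e, Real.log_mul (by norm_num) (by positivity), Real.log_pow]
    push_cast; ring
  rw [this, integral_add (c_int _) (log1_int.const_mul 2), intervalIntegral.integral_const_mul,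
    intervalIntegral.integral_const_mul, int_one_div, log1_val]
  ring

lemma Ti2_one : Ti2 1 = catalanG := by
  unfold Ti2 catalanG
  rw [integral_of_le zero_le_one]
  have hi : ∀ k : ℕ, ∫ x in Set.Ioc (0:ℝ) 1, x ^ (2 * k) / (2 * (k:ℝ) + 1) = 1 / (2 * (k:ℝ) + 1) ^ 2 := fun k => by
    rw [← integral_of_le zero_le_one, intervalIntegral.integral_div, integral_pow]
    push_cast
    simp
    field_simp
  have hI : ∀ k : ℕ, Integrable (fun x : ℝ => x ^ (2 * k) / (2 * (k:ℝ) + 1)) (volume.restrict (Set.Ioc 0 1)) := fun k => by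
    have : IntervalIntegrable (fun x : ℝ => x ^ (2 * k) / (2 * (k:ℝ) + 1)) volume 0 1 :=
      Continuous.intervalIntegrable (by fun_prop) _ _
    rwa [intervalIntegrable_iff_integrableOn_Ioc_of_le zero_le_one] at this
  have hsum : Summable (fun k : ℕ => 1 / (2 * (k:ℝ) + 1) ^ 2) := by
    have h := (summable_nat_add_iff 1).2 (Real.summable_one_div_nat_pow.2 one_lt_two)
    refine Summable.of_nonneg_of_le (fun k => by positivity) (fun k => ?_) h
    push_cast
    gcongr
    linarith [(Nat.cast_nonneg k : (0:ℝ) ≤ k)]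
  have hs := hasSum_integral_of_summable_integral_norm (μ := volume.restrict (Set.Ioc (0:ℝ) 1))
    (F := fun (k : ℕ) (x : ℝ) => (-1) ^ k * (x ^ (2 * k) / (2 * (k:ℝ) + 1))) (fun k => (hI k).const_mul _) ?_
  · have h1 : ∫ a in Set.Ioc (0:ℝ) 1, ∑' k : ℕ, (-1) ^ k * (a ^ (2 * k) / (2 * (k:ℝ) + 1)) = ∫ u in Set.Ioc (0:ℝ) 1, arctan u / u := by
      rw [integral_Ioc_eq_integral_Ioo, integral_Ioc_eq_integral_Ioo]
      refine setIntegral_congr_fun measurableSet_Ioo fun x hx => ?_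
      have h := (Real.hasSum_arctan (x := x) (by rw [Real.norm_eq_abs, abs_of_pos hx.1]; exact hx.2)).div_const x
      rw [← h.tsum_eq]
      congr 1; ext k
      have := hx.1.ne'
      push_cast
      field_simp
      ring
    rw [← h1, ← hs.tsum_eq]
    congr 1; ext k
    rw [MeasureTheory.integral_const_mul, hi]; ring
  · convert hsum using 2 with k
    rw [← hi]
    refine setIntegral_congr_fun measurableSet_Ioc fun x hx => ?_
    have := hx.1
    simp only [norm_mul, norm_pow, norm_neg, norm_one, one_pow, one_mul, Real.norm_eq_abs]
    exact abs_of_nonneg (by positivity)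

theorem stmt_11 :
    ∫ x in (0:ℝ)..1, Real.log (x ^ 5 + 1) / (x ^ 2 + 1) =
      -(3 * π / 8) * Real.log 2 - 2 * catalanG
        + Ti2 (1 + Real.sqrt 5 - Real.sqrt (5 + 2 * Real.sqrt 5))
        + Ti2 (1 - Real.sqrt 5 + Real.sqrt (5 - 2 * Real.sqrt 5))
        + (π / 2) * Real.log (1 + Real.sqrt 5 + Real.sqrt (10 + 2 * Real.sqrt 5)) := by
  set s := Real.sqrt 5 with hs
  have hs2 : s ^ 2 = 5 := Real.sq_sqrt (by norm_num)
  have hs0 : 0 ≤ s := Real.sqrt_nonneg _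
  have hsl : 2.236 < s := by rw [hs]; apply Real.lt_sqrt_of_sq_lt; norm_num
  have hsu : s < 2.237 := by rw [hs, Real.sqrt_lt' (by norm_num)]; norm_num
  set a := Real.sqrt (5 + 2 * s) with ha
  have ha2 : a ^ 2 = 5 + 2 * s := Real.sq_sqrt (by positivity)
  have ha0 : 0 ≤ a := Real.sqrt_nonneg _
  have hal : 3.07 < a := by rw [ha]; apply Real.lt_sqrt_of_sq_lt; norm_num; linarith
  have hau : a < 3.08 := by rw [ha, Real.sqrt_lt' (by norm_num)]; norm_num; linarith
  have hb : Real.sqrt (5 - 2 * s) = (s - 2) * a := by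
    rw [Real.sqrt_eq_iff_mul_self_eq (by linarith) (mul_nonneg (by linarith) ha0)]
    grind
  have hc : Real.sqrt (10 + 2 * s) = (s - 1) * a := by
    rw [Real.sqrt_eq_iff_mul_self_eq (by linarith) (mul_nonneg (by linarith) ha0)]
    grind
  rw [hb, hc]
  set t := 1 + s - a with ht
  set v := 1 - s + (s - 2) * a with hv
  have htm : -1 < t := by linarith
  have ht1 : t ≤ 1 := by linarith
  have hvm : -1 < v := by nlinarith
  have hv1 : v ≤ 1 := by nlinarith
  have hts : 8 * t = (s - 1) * (1 + t ^ 2) := by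
    clear_value t v a s
    subst ht
    clear hs ha hb hc hv hsl hsu hal hau htm ht1 hvm hv1
    grind
  have hvs : 8 * v = - (s + 1) * (1 + v ^ 2) := by
    clear_value t v a s
    subst hv
    clear hs ha hb hc ht hts hsl hsu hal hau htm ht1 hvm hv1
    grind
  have hP : (1 + t ^ 2) * (1 + v ^ 2) * (1 + s + (s - 1) * a) ^ 2 = 64 := by
    clear_value t v a s
    subst ht hv
    clear hs ha hb hc hts hvs hsl hsu hal hau htm ht1 hvm hv1
    grind
  have hA : 0 < 1 + s + (s - 1) * a := by nlinarith
  have hlogP : Real.log ((1 + t ^ 2) * (1 + v ^ 2)) = 6 * Real.log 2 - 2 * Real.log (1 + s + (s - 1) * a) := by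
    have h := congrArg Real.log hP
    rw [Real.log_mul (by positivity) (by positivity), Real.log_pow,
      (by norm_num : (64:ℝ) = 2 ^ 6), Real.log_pow] at h
    push_cast at h
    linarith
  have hG : qL 0 = π / 2 * Real.log 2 - catalanG := by
    have := qL_eq (t := 1) (by norm_num) le_rfl
    rw [qL_one, Ti2_one] at this
    linarith
  have hqt := qL_eq htm ht1
  have hqv := qL_eq hvm hv1
  have main : ∫ x in (0:ℝ)..1, Real.log (x ^ 5 + 1) / (x ^ 2 + 1) =
      ∫ x in (0:ℝ)..1, (((Real.log (1 + x) / (1 + x ^ 2) + Real.log (qD t x) / (1 + x ^ 2))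
        + Real.log (qD v x) / (1 + x ^ 2)) - Real.log ((1 + t ^ 2) * (1 + v ^ 2)) * (1 / (1 + x ^ 2))) := by
    apply integral_congr
    intro x hx
    rw [Set.uIcc_of_le zero_le_one] at hx
    have h1 : 0 < 1 + x := by linarith [hx.1]
    have h2 := qD_pos htm hx
    have h3 := qD_pos hvm hx
    have h0 := hx.1
    have e : (1 + x) * qD t x * qD v x = (x ^ 5 + 1) * ((1 + t ^ 2) * (1 + v ^ 2)) := by
      have e1 : qD t x = (1 + t ^ 2) * (1 + x ^ 2 + (s - 1) / 2 * x) := by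
        unfold qD; linear_combination x / 2 * hts
      have e2 : qD v x = (1 + v ^ 2) * (1 + x ^ 2 - (s + 1) / 2 * x) := by
        unfold qD; linear_combination x / 2 * hvs
      rw [e1, e2]
      linear_combination (-((1 + t ^ 2) * (1 + v ^ 2) * (1 + x) * x ^ 2 / 4)) * hs2
    have h := congrArg Real.log e
    rw [Real.log_mul (by positivity) h3.ne', Real.log_mul h1.ne' h2.ne',
      Real.log_mul (by positivity) (by positivity)] at h
    simp only
    rw [add_comm (x ^ 2) 1, eq_sub_of_add_eq h.symm]
    ring
  rw [main, integral_sub ((log1_int.add (qlog_int htm)).add (qlog_int hvm)) (c_int _),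
    integral_add (log1_int.add (qlog_int htm)) (qlog_int hvm),
    integral_add log1_int (qlog_int htm), intervalIntegral.integral_const_mul, int_one_div, log1_val, hlogP]
  change π / 8 * Real.log 2 + qL t + qL v - _ = _
  rw [hqt, hqv, hG]
  ring
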